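/- Let d ≥ 2 and let E ⊆ ℝ^d be a measurable set of finite Lebesgue measure. If limsup_{r→0⁺} J̃_r^s(E)/σ^s(r) < +∞ for some s ≥ 1, then E is a set of finite perimeter. -/

import Mathlib

open MeasureTheory Filter Set Metric
open scoped ENNReal NNReal symmDiff

noncomputable section

abbrev Euc (d : ℕ) : Type := EuclideanSpace ℝ (Fin d)

/-- The kernel `k^s_r`. -/
def ker (d : ℕ) (s r t : ℝ) : ℝ :=
  if t ≤ r then r ^ (-((d : ℝ) + s)) else t ^ (-((d : ℝ) + s))

/-- The regularized `s`-fractional perimeter `J̃_r^s(E) = ∫_E ∫_{Eᶜ} k^s_r(|x-y|) dy dx`. -/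
def Jt (d : ℕ) (s r : ℝ) (E : Set (Euc d)) : ℝ≥0∞ :=
  ∫⁻ x in E, ∫⁻ y in Eᶜ, ENNReal.ofReal (ker d s r (dist x y))

/-- The scaling factor `σ^s(r)`. -/
def sgm (d : ℕ) (s r : ℝ) : ℝ :=
  if s = 1 then |Real.log r| else (((d : ℝ) + s) / ((d : ℝ) + 1)) * r ^ (1 - s) / (s - 1)

/-- The scaling factor `β(r,s)` for the simultaneous limit. -/
def betaScale (d : ℕ) (s r : ℝ) : ℝ :=
  (((d : ℝ) + s) / ((d : ℝ) + 1)) * ((r ^ (1 - s) - 1) / (s - 1)) + 1 / ((d : ℝ) + 1)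

/-- `ω_k`: Lebesgue measure of the unit ball in `ℝ^k`. -/
def omegaB (k : ℕ) : ℝ := (volume (ball (0 : Euc k) 1)).toReal

/-- Divergence of a vector field on `ℝ^d`. -/
def diverg {d : ℕ} (Φ : Euc d → Euc d) (x : Euc d) : ℝ :=
  ∑ i : Fin d, fderiv ℝ Φ x (EuclideanSpace.single i 1) i

/-- De Giorgi perimeter. -/
def Per (d : ℕ) (E : Set (Euc d)) : ℝ≥0∞ :=
  ⨆ (Φ : Euc d → Euc d) (_ : ContDiff ℝ 1 Φ) (_ : HasCompactSupport Φ)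
    (_ : ∀ x, ‖Φ x‖ ≤ 1), ENNReal.ofReal (∫ x in E, diverg Φ x)

/-- The cube `lQ + ξ` where `Q = [-1/2, 1/2)^d`. -/
def cube (d : ℕ) (l : ℝ) (ξ : Euc d) : Set (Euc d) :=
  {x | ∀ i, x i ∈ Set.Ico (ξ i - l / 2) (ξ i + l / 2)}

/-- Half space `H⁻_ν(0)`. -/
def Hminus (d : ℕ) (ν : Euc d) : Set (Euc d) := {y | @inner ℝ _ _ ν y ≤ 0}

/-- Standard (normalized) `k`-dimensional Hausdorff measure on `ℝ^d`:
Mathlib's `μH[k]` uses `diam^k` gauges without the normalizing constant `ω_k/2^k`. -/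
def Hstd (d : ℕ) (k : ℕ) : Measure (Euc d) :=
  (ENNReal.ofReal (omegaB k / 2 ^ k)) • (μH[(k : ℝ)] : Measure (Euc d))

/-- The nonlocal `k^s_r`-curvature. -/
def curv (d : ℕ) (s r : ℝ) (E : Set (Euc d)) (x : Euc d) : ℝ :=
  ∫ y, (Set.indicator Eᶜ (fun _ => (1 : ℝ)) y - Set.indicator E (fun _ => (1 : ℝ)) y)
    * ker d s r (dist x y)

/-- The class `𝔈`: closures of open sets with compact `C²` boundary. -/
def IsC2Domain (d : ℕ) (E : Set (Euc d)) : Prop :=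
  ∃ U : Set (Euc d), IsOpen U ∧ E = closure U ∧ IsCompact (frontier U) ∧
    ∃ f : Euc d → ℝ, ContDiff ℝ 2 f ∧ U = {x | f x < 0} ∧ frontier U = {x | f x = 0} ∧
      ∀ x ∈ frontier U, fderiv ℝ f x ≠ 0

def AA {d : ℕ} (E : Set (Euc d)) (v : Euc d) : ℝ≥0∞ :=
  ∫⁻ x, E.indicator 1 x * Eᶜ.indicator 1 (x + v)

lemma AA_eq {d : ℕ} {E : Set (Euc d)} (hE : MeasurableSet E) (v : Euc d) :
    AA E v = volume (E ∩ (fun x => x + v) ⁻¹' Eᶜ) := by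
  have hm : MeasurableSet (E ∩ (fun x => x + v) ⁻¹' Eᶜ) :=
    hE.inter ((measurable_add_const v) hE.compl)
  rw [← lintegral_indicator_one hm, AA]
  congr 1
  ext x
  by_cases h1 : x ∈ E <;> by_cases h2 : x + v ∈ E <;> simp [Set.indicator, h1, h2]

lemma AA_meas {d : ℕ} {E : Set (Euc d)} (hE : MeasurableSet E) : Measurable (AA E) := by
  unfold AA
  apply Measurable.lintegral_prod_right' (f := fun p : Euc d × Euc d =>
    E.indicator (1 : Euc d → ℝ≥0∞) p.2 * Eᶜ.indicator 1 (p.2 + p.1))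
  have h1 : Measurable (E.indicator (1 : Euc d → ℝ≥0∞)) := measurable_one.indicator hE
  have h2 : Measurable (Eᶜ.indicator (1 : Euc d → ℝ≥0∞)) := measurable_one.indicator hE.compl
  fun_prop

lemma AA_add {d : ℕ} {E : Set (Euc d)} (hE : MeasurableSet E) (v w : Euc d) :
    AA E (v + w) ≤ AA E v + AA E w := by
  rw [AA_eq hE, AA_eq hE, AA_eq hE]
  have : volume ((fun x => x + v) ⁻¹' (E ∩ (fun x => x + w) ⁻¹' Eᶜ))
      = volume (E ∩ (fun x => x + w) ⁻¹' Eᶜ) := measure_preimage_add_right _ _ _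
  rw [← this]
  refine (measure_mono ?_).trans (measure_union_le _ _)
  rintro x ⟨h1, h2⟩
  simp only [Set.mem_preimage, Set.mem_compl_iff, Set.mem_union, Set.mem_inter_iff] at *
  rw [← add_assoc] at h2
  tauto

lemma AA_nsmul {d : ℕ} {E : Set (Euc d)} (hE : MeasurableSet E) (v : Euc d) (n : ℕ) :
    AA E (n • v) ≤ n * AA E v := by
  induction n with
  | zero => simp [AA_eq hE]
  | succ n ih =>
    rw [succ_nsmul]
    refine (AA_add hE _ _).trans ?_
    push_cast
    rw [add_mul, one_mul]
    gcongr

lemma ker_meas (d : ℕ) (s r : ℝ) : Measurable (_root_.ker d s r) := by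
  unfold _root_.ker
  exact Measurable.ite measurableSet_Iic measurable_const (by fun_prop)

lemma Jt_eq {d : ℕ} {E : Set (Euc d)} (hE : MeasurableSet E) (s r : ℝ) :
    Jt d s r E = ∫⁻ h, ENNReal.ofReal (_root_.ker d s r ‖h‖) * AA E h := by
  have hk := ker_meas d s r
  have h1 : Measurable (E.indicator (1 : Euc d → ℝ≥0∞)) := measurable_one.indicator hE
  have h2 : Measurable (Eᶜ.indicator (1 : Euc d → ℝ≥0∞)) := measurable_one.indicator hE.compl
  have e1 : Jt d s r E = ∫⁻ x, ∫⁻ h, ENNReal.ofReal (_root_.ker d s r ‖h‖) *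
      (E.indicator (1 : Euc d → ℝ≥0∞) x * Eᶜ.indicator 1 (x + h)) := by
    unfold Jt
    rw [← lintegral_indicator hE]
    congr 1
    ext x
    by_cases hx : x ∈ E
    · simp only [Set.indicator_of_mem hx]
      rw [← lintegral_indicator hE.compl, ← lintegral_add_left_eq_self _ x]
      congr 1
      ext h
      by_cases h2 : x + h ∈ E <;> simp [Set.indicator, h2]
    · simp [Set.indicator_of_notMem hx]
  rw [e1, lintegral_lintegral_swap]
  · congr 1
    ext h
    rw [lintegral_const_mul _ (by fun_prop), AA]
  · apply Measurable.aemeasurable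
    simp only [Function.uncurry_def]
    fun_prop

lemma AA_ball {d : ℕ} {E : Set (Euc d)} (hE : MeasurableSet E) (u : Euc d) (R : ℝ) :
    AA E u * volume (ball ((1/2 : ℝ) • u) R) ≤ 2 * ∫⁻ h in ball ((1/2 : ℝ) • u) R, AA E h := by
  set B := ball ((1/2 : ℝ) • u) R
  have hA := AA_meas hE
  have hB : MeasurableSet B := measurableSet_ball
  have e : ∫⁻ h in B, AA E (u - h) = ∫⁻ h in B, AA E h := by
    rw [← lintegral_indicator hB, ← lintegral_indicator hB,
      ← lintegral_sub_left_eq_self (B.indicator (AA E)) u]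
    congr 1
    ext h
    have : u - h ∈ B ↔ h ∈ B := by
      simp only [B, mem_ball, dist_eq_norm]
      rw [← norm_neg]
      have : -(u - h - (1/2 : ℝ) • u) = h - (1/2 : ℝ) • u := by module
      rw [this]
    by_cases hb : h ∈ B
    · rw [Set.indicator_of_mem hb, Set.indicator_of_mem (this.2 hb)]
    · rw [Set.indicator_of_notMem hb, Set.indicator_of_notMem (fun h' => hb (this.1 h'))]
  calc _ = ∫⁻ h in B, AA E u := by simp
    _ ≤ ∫⁻ h in B, (AA E h + AA E (u - h)) := by
      apply lintegral_mono
      intro h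
      have := AA_add hE h (u - h)
      simpa using this
    _ = _ := by rw [lintegral_add_left hA, e, two_mul]

def cc (d : ℕ) : ℝ := (1/4 : ℝ) ^ d * omegaB d / 2

lemma cc_pos (d : ℕ) : 0 < cc d := by
  have : 0 < omegaB d :=
    ENNReal.toReal_pos (measure_ball_pos _ _ one_pos).ne' measure_ball_lt_top.ne
  unfold cc
  positivity

lemma key {d : ℕ} {E : Set (Euc d)} (hE : MeasurableSet E) (s r : ℝ) (hs : 1 ≤ s) (hr : 0 < r)
    (u : Euc d) (hu : r ≤ ‖u‖) :
    ENNReal.ofReal (cc d * ‖u‖ ^ (-s)) * AA E u ≤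
      ∫⁻ h in ball ((1/2 : ℝ) • u) (‖u‖ / 4), ENNReal.ofReal (_root_.ker d s r ‖h‖) * AA E h := by
  have hu0 : 0 < ‖u‖ := hr.trans_le hu
  have hA := AA_meas hE
  have h1 := AA_ball hE u (‖u‖ / 4)
  have hv : volume (ball ((1/2 : ℝ) • u) (‖u‖ / 4)) =
      2 * ENNReal.ofReal (cc d * ‖u‖ ^ d) := by
    rw [Measure.addHaar_ball_of_pos _ _ (by positivity)]
    have : volume (ball (0 : Euc d) 1) = ENNReal.ofReal (omegaB d) :=
      (ENNReal.ofReal_toReal measure_ball_lt_top.ne).symm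
    rw [this, ← ENNReal.ofReal_mul (by positivity)]
    have h22 : (2 : ℝ≥0∞) * ENNReal.ofReal (cc d * ‖u‖ ^ d) = ENNReal.ofReal (2 * (cc d * ‖u‖ ^ d)) := by
      rw [ENNReal.ofReal_mul (p := 2) zero_le_two, ENNReal.ofReal_ofNat]
    rw [h22]
    congr 1
    simp [cc, div_pow]
    ring
  rw [hv, mul_left_comm] at h1
  have h2 : AA E u * ENNReal.ofReal (cc d * ‖u‖ ^ d) ≤
      ∫⁻ h in ball ((1/2 : ℝ) • u) (‖u‖ / 4), AA E h :=
    (ENNReal.mul_le_mul_iff_right (by simp) (by simp)).1 h1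
  have h3 : ENNReal.ofReal (cc d * ‖u‖ ^ (-s)) =
      ENNReal.ofReal (‖u‖ ^ (-((d : ℝ) + s))) * ENNReal.ofReal (cc d * ‖u‖ ^ d) := by
    rw [← ENNReal.ofReal_mul (by positivity)]
    congr 1
    rw [neg_add, Real.rpow_add hu0, Real.rpow_neg hu0.le (d : ℝ), Real.rpow_natCast]
    field_simp
  rw [h3, mul_assoc, mul_comm (ENNReal.ofReal (cc d * _))]
  refine (mul_le_mul_right h2 _).trans ?_
  rw [← lintegral_const_mul _ hA]
  apply setLIntegral_mono' measurableSet_ball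
  intro h hh
  gcongr
  have hh' : ‖h‖ ≤ ‖u‖ := by
    rw [mem_ball, dist_eq_norm] at hh
    have := norm_le_norm_add_norm_sub' h ((1/2 : ℝ) • u)
    rw [norm_smul] at this
    norm_num at this hh
    linarith
  unfold _root_.ker
  split_ifs with hc
  · exact Real.rpow_le_rpow_of_nonpos hr hu (by linarith [(Nat.cast_nonneg d : (0:ℝ) ≤ d)])
  · exact Real.rpow_le_rpow_of_nonpos (by linarith) hh' (by linarith [(Nat.cast_nonneg d : (0:ℝ) ≤ d)])

lemma Jt_ge {d : ℕ} {E : Set (Euc d)} (hE : MeasurableSet E) (s : ℝ) (hs : 1 ≤ s)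
    (v : Euc d) (hv : v ≠ 0) (N : ℕ) :
    ∑ j ∈ Finset.range (N+1), ENNReal.ofReal (cc d * (‖v‖ * (1/3) ^ j) ^ (-s) * (1/3) ^ j) * AA E v
      ≤ Jt d s (‖v‖ * (1/3) ^ N) E := by
  have hv0 : 0 < ‖v‖ := norm_pos_iff.2 hv
  set u : ℕ → Euc d := fun j => ((1/3 : ℝ) ^ j) • v with hudef
  have hun : ∀ j, ‖u j‖ = ‖v‖ * (1/3) ^ j := by
    intro j
    simp [u, norm_smul, mul_comm]
  have hterm : ∀ j ∈ Finset.range (N+1),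
      ENNReal.ofReal (cc d * (‖v‖ * (1/3) ^ j) ^ (-s) * (1/3) ^ j) * AA E v ≤
      ∫⁻ h in ball ((1/2 : ℝ) • u j) (‖u j‖ / 4),
        ENNReal.ofReal (_root_.ker d s (‖v‖ * (1/3) ^ N) ‖h‖) * AA E h := by
    intro j hj
    have hj' : j ≤ N := by simpa [Nat.lt_succ_iff] using hj
    refine le_trans ?_ (key hE s _ hs (by positivity) (u j) ?_)
    · rw [hun, ENNReal.ofReal_mul (by have := cc_pos d; positivity), mul_assoc]
      gcongr
      have h1 := AA_nsmul hE (u j) (3 ^ j)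
      have h2 : (3 ^ j : ℕ) • u j = v := by
        rw [← Nat.cast_smul_eq_nsmul ℝ, hudef]
        simp only [smul_smul]
        push_cast
        rw [← mul_pow]
        norm_num
      rw [h2] at h1
      calc _ ≤ ENNReal.ofReal ((1/3) ^ j) * (((3 ^ j : ℕ) : ℝ≥0∞) * AA E (u j)) := by gcongr
        _ = AA E (u j) := by
          rw [← mul_assoc, ← ENNReal.ofReal_natCast, ← ENNReal.ofReal_mul (by positivity)]
          push_cast
          rw [← mul_pow]
          norm_num
    · rw [hun]
      gcongr ?_ * ?_
      exact pow_le_pow_of_le_one (by norm_num) (by norm_num) hj'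
  refine (Finset.sum_le_sum hterm).trans ?_
  rw [Jt_eq hE, ← lintegral_biUnion_finset]
  · exact setLIntegral_le_lintegral _ _
  · have hb : ∀ j h, h ∈ ball ((1/2 : ℝ) • u j) (‖u j‖ / 4) →
        ‖v‖ * (1/3) ^ j * (1/4) < ‖h‖ ∧ ‖h‖ < ‖v‖ * (1/3) ^ j * (3/4) := by
      intro j h hh
      rw [mem_ball, dist_eq_norm] at hh
      have h1 := norm_le_norm_add_norm_sub' h ((1/2 : ℝ) • u j)
      have h2 := norm_le_norm_add_norm_sub h ((1/2 : ℝ) • u j)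
      rw [norm_smul, hun] at h1 h2
      rw [hun] at hh
      rw [show ‖(1/2:ℝ)‖ = 1/2 by norm_num] at h1 h2
      constructor <;> linarith
    have hlt : ∀ i j, i < j → Disjoint (ball ((1/2 : ℝ) • u i) (‖u i‖ / 4))
        (ball ((1/2 : ℝ) • u j) (‖u j‖ / 4)) := by
      intro i j hij
      rw [Set.disjoint_left]
      intro h hi hj
      have a := (hb i h hi).1
      have b := (hb j h hj).2
      have : (1/3 : ℝ) ^ j ≤ (1/3) ^ (i+1) := pow_le_pow_of_le_one (by norm_num) (by norm_num) hij
      rw [pow_succ] at this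
      have : ‖v‖ * (1/3 : ℝ) ^ j ≤ ‖v‖ * ((1/3) ^ i * (1/3)) := by gcongr
      linarith
    intro i _ j _ hij
    rcases lt_or_gt_of_ne hij with h | h
    · exact hlt i j h
    · exact (hlt j i h).symm
  · intro j _
    exact measurableSet_ball

lemma AA_le {d : ℕ} {E : Set (Euc d)} (hE : MeasurableSet E) (hEfin : volume E < ⊤)
    (s : ℝ) (hs : 1 ≤ s)
    (h : Filter.limsup (fun r : ℝ => Jt d s r E / ENNReal.ofReal (sgm d s r))
      (nhdsWithin 0 (Set.Ioi 0)) < ⊤) :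
    ∃ C : ℝ, ∀ v : Euc d, (AA E v).toReal ≤ C * ‖v‖ := by
  have hAfin : ∀ v, AA E v ≠ ⊤ := fun v => by
    rw [AA_eq hE]
    exact ((measure_mono Set.inter_subset_left).trans_lt hEfin).ne
  obtain ⟨L, hL1, hL2⟩ := exists_between h
  have hev := eventually_lt_of_limsup_lt hL1
  have hc := cc_pos d
  have hsg : ∀ r : ℝ, 0 < r → r < 1 → 0 < sgm d s r := by
    intro r h0 h1
    unfold sgm
    split_ifs with h
    · exact abs_pos.2 (Real.log_neg h0 h1).ne
    · have : 0 < s - 1 := by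
        rcases lt_or_eq_of_le hs with h' | h'
        · linarith
        · exact absurd h'.symm h
      positivity
  have hev1 : ∀ᶠ r : ℝ in nhdsWithin 0 (Set.Ioi 0), Jt d s r E ≤ ENNReal.ofReal (L.toReal * sgm d s r) := by
    have h01 : ∀ᶠ r : ℝ in nhdsWithin 0 (Set.Ioi 0), r ∈ Set.Ioo (0:ℝ) 1 :=
      Ioo_mem_nhdsGT one_pos
    filter_upwards [hev, h01] with r hr hr1
    have hp := hsg r hr1.1 hr1.2
    rw [ENNReal.ofReal_mul (by positivity), ENNReal.ofReal_toReal hL2.ne]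
    exact (ENNReal.div_le_iff (by simpa using hp) (by simp)).1 hr.le
  set l := L.toReal
  have hl0 : 0 ≤ l := ENNReal.toReal_nonneg
  -- sequences
  have hseq : ∀ v : Euc d, v ≠ 0 → ∀ᶠ N : ℕ in atTop,
      ∑ j ∈ Finset.range (N+1), cc d * (‖v‖ * (1/3) ^ j) ^ (-s) * (1/3) ^ j * (AA E v).toReal
      ≤ l * sgm d s (‖v‖ * (1/3) ^ N) := by
    intro v hv
    have hv0 : 0 < ‖v‖ := norm_pos_iff.2 hv
    have ht : Tendsto (fun N : ℕ => ‖v‖ * (1/3 : ℝ) ^ N) atTop (nhdsWithin 0 (Set.Ioi 0)) := by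
      rw [tendsto_nhdsWithin_iff]
      constructor
      · have := (tendsto_pow_atTop_nhds_zero_of_lt_one (r := (1/3 : ℝ)) (by norm_num) (by norm_num)).const_mul ‖v‖
        simpa using this
      · exact Eventually.of_forall fun N => by
          simp only [Set.mem_Ioi]; positivity
    have h01 : ∀ᶠ r : ℝ in nhdsWithin 0 (Set.Ioi 0), r ∈ Set.Ioo (0:ℝ) 1 :=
      Ioo_mem_nhdsGT one_pos
    filter_upwards [ht.eventually hev1, ht.eventually h01] with N hN hN1
    have h1 := (Jt_ge hE s hs v hv N).trans hN
    have hp := hsg _ hN1.1 hN1.2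
    rw [← ENNReal.ofReal_le_ofReal_iff (by positivity)]
    refine le_trans (le_of_eq ?_) h1
    rw [ENNReal.ofReal_sum_of_nonneg (fun i _ => by positivity)]
    refine Finset.sum_congr rfl fun j _ => ?_
    rw [ENNReal.ofReal_mul (by positivity), ENNReal.ofReal_toReal (hAfin v)]
  suffices hC : ∃ C : ℝ, ∀ v : Euc d, v ≠ 0 → cc d * ((AA E v).toReal / ‖v‖) ≤ C by
    obtain ⟨C, hC⟩ := hC
    refine ⟨C / cc d, fun v => ?_⟩
    by_cases hv : v = 0
    · subst hv
      simp [AA_eq hE]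
    · have hv0 : 0 < ‖v‖ := norm_pos_iff.2 hv
      have := hC v hv
      rw [← div_le_iff₀ hv0, le_div_iff₀ hc]
      linarith
  rcases eq_or_lt_of_le hs with hs1 | hs1
  · subst hs1
    refine ⟨2 * l * Real.log 3, fun v hv => ?_⟩
    have hv0 : 0 < ‖v‖ := norm_pos_iff.2 hv
    have hl3 : 0 < Real.log 3 := Real.log_pos (by norm_num)
    obtain ⟨N, hN, hN2⟩ := ((hseq v hv).and
      (eventually_ge_atTop (⌈|Real.log ‖v‖| / Real.log 3⌉₊))).exists
    have hN3 : |Real.log ‖v‖| ≤ N * Real.log 3 := by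
      rw [← div_le_iff₀ hl3]
      exact Nat.ceil_le.1 hN2
    have hsum : ∀ j ∈ Finset.range (N+1), cc d * (‖v‖ * (1/3) ^ j) ^ (-(1:ℝ)) * (1/3) ^ j * (AA E v).toReal = cc d * ((AA E v).toReal / ‖v‖) := by
      intro j _
      rw [Real.rpow_neg_one]
      field_simp
    rw [Finset.sum_congr rfl hsum] at hN
    simp only [Finset.sum_const, Finset.card_range, nsmul_eq_mul, sgm, if_true] at hN
    have hlog : |Real.log (‖v‖ * (1/3) ^ N)| ≤ 2 * (N * Real.log 3) := by
      rw [Real.log_mul hv0.ne' (by positivity), Real.log_pow, one_div, Real.log_inv]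
      refine (abs_add_le _ _).trans ?_
      have : |(N:ℝ) * -Real.log 3| = N * Real.log 3 := by
        rw [mul_neg, abs_neg, abs_of_nonneg (by positivity)]
      rw [this]
      linarith
    have h2 : ((N + 1 : ℕ) : ℝ) * (cc d * ((AA E v).toReal / ‖v‖)) ≤ ((N+1 : ℕ) : ℝ) * (2 * l * Real.log 3) := by
      refine hN.trans ((mul_le_mul_of_nonneg_left hlog hl0).trans ?_)
      push_cast
      have : 0 ≤ l * Real.log 3 := by positivity
      nlinarith
    exact le_of_mul_le_mul_left h2 (by positivity)
  · refine ⟨l * (((d : ℝ) + s) / ((d : ℝ) + 1) / (s - 1)), fun v hv => ?_⟩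
    have hv0 : 0 < ‖v‖ := norm_pos_iff.2 hv
    obtain ⟨N, hN⟩ := (hseq v hv).exists
    have h1 := (Finset.single_le_sum (f := fun j => cc d * (‖v‖ * (1/3) ^ j) ^ (-s) * (1/3) ^ j * (AA E v).toReal) (fun i _ => by positivity) (Finset.self_mem_range_succ N)).trans hN
    simp only [sgm, if_neg hs1.ne'] at h1
    set r := ‖v‖ * (1/3 : ℝ) ^ N with hr
    have hr0 : 0 < r := by positivity
    have e1 : r ^ (1 - s) = r * r ^ (-s) := by
      rw [sub_eq_add_neg, Real.rpow_add hr0, Real.rpow_one]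
    have hp : 0 < r ^ (1 - s) := by positivity
    refine le_of_mul_le_mul_right (a := r ^ (1 - s)) ?_ hp
    refine le_trans (le_of_eq ?_) (h1.trans (le_of_eq ?_))
    · rw [e1]
      have : r / ‖v‖ = (1/3) ^ N := by rw [hr]; field_simp
      rw [← this]
      field_simp
    · ring

lemma shift_bound {d : ℕ} {E : Set (Euc d)} (hE : MeasurableSet E) (hEfin : volume E < ⊤)
    (f : Euc d → ℝ) (hf : Continuous f) (hb : ∀ x, |f x| ≤ 1) (v : Euc d) :
    ∫ x in E, (f (x + v) - f x) ≤ (AA E v).toReal + (AA E (-v)).toReal := by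
  set F := (fun x => x - v) ⁻¹' E with hF
  have hFm : MeasurableSet F := (measurable_sub_const v) hE
  have hFv : volume F = volume E := by
    simp only [hF, sub_eq_add_neg]
    exact measure_preimage_add_right _ _ _
  have hint : ∀ S : Set (Euc d), volume S < ⊤ → IntegrableOn f S := fun S hS =>
    Measure.integrableOn_of_bounded (M := 1) hS.ne hf.aestronglyMeasurable
      (Eventually.of_forall hb)
  have hFfin : volume F < ⊤ := hFv ▸ hEfin
  have hi2 : IntegrableOn (fun x => f (x + v)) E :=
    Measure.integrableOn_of_bounded (M := 1) hEfin.ne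
      (by fun_prop) (Eventually.of_forall fun x => hb _)
  have e1 : ∫ x in E, f (x + v) = ∫ x in F, f x := by
    rw [← integral_indicator hE, ← integral_indicator hFm,
      ← integral_add_right_eq_self (F.indicator f) v]
    congr 1
    ext x
    have hx : x + v ∈ F ↔ x ∈ E := by simp [hF]
    by_cases hb : x ∈ E
    · rw [Set.indicator_of_mem hb, Set.indicator_of_mem (hx.2 hb)]
    · rw [Set.indicator_of_notMem hb, Set.indicator_of_notMem (fun h' => hb (hx.1 h'))]
  rw [integral_sub hi2 (hint E hEfin), e1]
  rw [← integral_inter_add_sdiff hE (hint F hFfin), ← integral_inter_add_sdiff hFm (hint E hEfin),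
    Set.inter_comm E F]
  have b : ∀ S : Set (Euc d), volume S < ⊤ → |∫ x in S, f x| ≤ (volume S).toReal := fun S hS => by
    have := norm_setIntegral_le_of_norm_le_const (C := 1) (f := f) hS (fun x _ => hb x)
    simpa [Measure.real] using this
  have b1 := b (F \ E) ((measure_mono Set.sdiff_subset).trans_lt hFfin)
  have b2 := b (E \ F) ((measure_mono Set.sdiff_subset).trans_lt hEfin)
  have v1 : volume (F \ E) = AA E v := by
    rw [AA_eq hE, ← measure_preimage_add_right _ v (F \ E)]
    congr 1
    ext x
    simp [hF]
  have v2 : volume (E \ F) = AA E (-v) := by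
    rw [AA_eq hE]
    congr 1
  rw [v1] at b1
  rw [v2] at b2
  have := (abs_le.1 b1).2
  have := (abs_le.1 b2).1
  linarith

lemma deriv_bound {d : ℕ} {E : Set (Euc d)} (hE : MeasurableSet E) (hEfin : volume E < ⊤)
    (C : ℝ) (hC : ∀ v : Euc d, (AA E v).toReal ≤ C * ‖v‖)
    (f : Euc d → ℝ) (hf : ContDiff ℝ 1 f) (hs : HasCompactSupport f) (hb : ∀ x, |f x| ≤ 1)
    (e : Euc d) (he : ‖e‖ = 1) :
    IntegrableOn (fun x => fderiv ℝ f x e) E ∧ ∫ x in E, fderiv ℝ f x e ≤ 2 * C := by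
  obtain ⟨K, hK⟩ := hf.lipschitzWith_of_hasCompactSupport hs (by norm_num)
  have hcd : Continuous (fun x => fderiv ℝ f x e) :=
    (hf.continuous_fderiv (by norm_num)).clm_apply continuous_const
  have hf' := hf.continuous
  refine ⟨Measure.integrableOn_of_bounded (M := K) hEfin.ne hcd.aestronglyMeasurable
      (Eventually.of_forall fun x => ?_), ?_⟩
  · refine (ContinuousLinearMap.le_opNorm _ _).trans ?_
    rw [he, mul_one]
    exact norm_fderiv_le_of_lipschitz ℝ hK
  have hlim : Tendsto (fun t : ℝ => ∫ x in E, t⁻¹ * (f (x + t • e) - f x)) (nhdsWithin 0 (Set.Ioi 0))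
      (nhds (∫ x in E, fderiv ℝ f x e)) := by
    apply tendsto_integral_filter_of_dominated_convergence (fun _ => (K : ℝ))
    · exact Eventually.of_forall fun t => by
        apply Continuous.aestronglyMeasurable; fun_prop
    · filter_upwards [self_mem_nhdsWithin] with t ht
      refine Eventually.of_forall fun x => ?_
      have ht : 0 < t := ht
      have := hK.norm_sub_le (x + t • e) x
      simp only [add_sub_cancel_left, norm_smul, he, mul_one, Real.norm_eq_abs, abs_of_pos ht] at this
      rw [norm_mul, norm_inv, Real.norm_eq_abs, Real.norm_eq_abs, abs_of_pos ht, inv_mul_le_iff₀ ht]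
      linarith
    · have : IsFiniteMeasure (volume.restrict E) := ⟨by simpa using hEfin⟩
      exact integrable_const _
    · refine Eventually.of_forall fun x => ?_
      have h1 := ((hf.differentiable (by norm_num)) x).hasFDerivAt.hasLineDerivAt e
      have h2 := HasLineDerivAt.tendsto_slope_zero_right h1
      simpa only [smul_eq_mul] using h2
  refine le_of_tendsto hlim ?_
  filter_upwards [self_mem_nhdsWithin] with t ht
  have ht : 0 < t := ht
  rw [integral_const_mul, inv_mul_le_iff₀ ht]
  refine (shift_bound hE hEfin f hf' hb (t • e)).trans ?_
  have h1 := hC (t • e)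
  have h2 := hC (-(t • e))
  rw [norm_neg] at h2
  rw [norm_smul, he, Real.norm_eq_abs, abs_of_pos ht] at h1 h2
  linarith

/-- If `limsup_{r→0⁺} J̃_r^s(E)/σ^s(r) < +∞` for some `s ≥ 1`, then the
finite-measure set `E` has finite perimeter. -/
theorem stmt10 (d : ℕ) (hd : 2 ≤ d)
    (E : Set (Euc d)) (hEmeas : MeasurableSet E) (hEfin : volume E < ⊤)
    (s : ℝ) (hs : 1 ≤ s)
    (h : Filter.limsup (fun r : ℝ => Jt d s r E / ENNReal.ofReal (sgm d s r))
      (nhdsWithin 0 (Set.Ioi 0)) < ⊤) :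
    Per d E < ⊤ := by
  obtain ⟨C, hC⟩ := AA_le hEmeas hEfin s hs h
  refine lt_of_le_of_lt (b := ENNReal.ofReal (∑ _i : Fin d, 2 * C)) ?_ ENNReal.ofReal_lt_top
  unfold Per
  refine iSup_le fun Φ => iSup_le fun h1 => iSup_le fun h2 => iSup_le fun h3 => ?_
  apply ENNReal.ofReal_le_ofReal
  have hi : ∀ i : Fin d, IntegrableOn (fun x => fderiv ℝ Φ x (EuclideanSpace.single i 1) i) E ∧
      ∫ x in E, fderiv ℝ Φ x (EuclideanSpace.single i 1) i ≤ 2 * C := by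
    intro i
    have hd1 : Differentiable ℝ Φ := h1.differentiable (by norm_num)
    have hfd : ∀ x, fderiv ℝ (fun y => Φ y i) x (EuclideanSpace.single i 1) =
        fderiv ℝ Φ x (EuclideanSpace.single i 1) i := by
      intro x
      have := ((EuclideanSpace.proj (𝕜 := ℝ) i).hasFDerivAt.comp x (hd1 x).hasFDerivAt).fderiv
      have h' : (⇑(EuclideanSpace.proj (𝕜 := ℝ) i) ∘ Φ) = fun y => Φ y i := rfl
      rw [h'] at this
      rw [this]
      rfl
    have := deriv_bound hEmeas hEfin C hC (fun y => Φ y i)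
      ((EuclideanSpace.proj (𝕜 := ℝ) i).contDiff.comp h1)
      (h2.comp_left (g := fun z : Euc d => z i) rfl)
      (fun x => (PiLp.norm_apply_le (Φ x) i).trans (h3 x))
      (EuclideanSpace.single i 1) (by simp)
    simpa only [hfd] using this
  unfold diverg
  rw [integral_finset_sum _ (fun i _ => (hi i).1)]
  exact Finset.sum_le_sum fun i _ => (hi i).2

end
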